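/- Let n and m be natural numbers, let Hxx be an n×n real symmetric matrix, Hxu an n×m real matrix, and Huu an m×m real positive definite matrix, and let H = fromBlocks Hxx Hxu Hxuᵀ Huu (indexed by Fin n ⊕ Fin m). Fix x : Fin n → ℝ and set u* := −(Huu⁻¹ * Hxuᵀ).mulVec x. Then u* is the unique minimizer of the function u ↦ (Sum.elim x u)ᵀ H (Sum.elim x u): for every u : Fin m → ℝ with u ≠ u*, one has (Sum.elim x u*)ᵀ H (Sum.elim x u*) < (Sum.elim x u)ᵀ H (Sum.elim x u). -/

import Mathlib

open Matrix

/-- The quadratic form of a symmetric block matrix, with the cross terms collected. -/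
lemma sumElim_dotProduct_fromBlocks_mulVec {ι κ : Type*} [Fintype ι] [Fintype κ]
    (A : Matrix ι ι ℝ) (B : Matrix ι κ ℝ) (D : Matrix κ κ ℝ) (x : ι → ℝ) (u : κ → ℝ) :
    Sum.elim x u ⬝ᵥ fromBlocks A B Bᵀ D *ᵥ Sum.elim x u =
      x ⬝ᵥ A *ᵥ x + 2 * (u ⬝ᵥ Bᵀ *ᵥ x) + u ⬝ᵥ D *ᵥ u := by
  have hcross : x ⬝ᵥ B *ᵥ u = u ⬝ᵥ Bᵀ *ᵥ x := by
    rw [dotProduct_mulVec, ← mulVec_transpose, dotProduct_comm]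
  rw [fromBlocks_mulVec, sumElim_dotProduct_sumElim]
  simp only [Sum.elim_comp_inl, Sum.elim_comp_inr, dotProduct_add, hcross]
  ring

/-- A solution of the stationarity equation `D s = -Bᵀ x` strictly minimizes the block quadratic
form in its second argument when `D` is positive definite. -/
lemma sumElim_dotProduct_fromBlocks_mulVec_lt {ι κ : Type*} [Fintype ι] [Fintype κ]
    (A : Matrix ι ι ℝ) (B : Matrix ι κ ℝ) {D : Matrix κ κ ℝ} (hD : D.PosDef) (x : ι → ℝ)
    {s u : κ → ℝ} (hs : D *ᵥ s = -(Bᵀ *ᵥ x)) (hu : u ≠ s) :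
    Sum.elim x s ⬝ᵥ fromBlocks A B Bᵀ D *ᵥ Sum.elim x s <
      Sum.elim x u ⬝ᵥ fromBlocks A B Bᵀ D *ᵥ Sum.elim x u := by
  have hpos : 0 < (u - s) ⬝ᵥ D *ᵥ (u - s) := by
    simpa using hD.dotProduct_mulVec_pos (sub_ne_zero.mpr hu)
  have hsymm : s ⬝ᵥ D *ᵥ u = u ⬝ᵥ D *ᵥ s := by
    have hT : Dᵀ = D := by simpa [IsHermitian] using hD.isHermitian
    rw [dotProduct_mulVec, ← mulVec_transpose, hT, dotProduct_comm]
  rw [sumElim_dotProduct_fromBlocks_mulVec, sumElim_dotProduct_fromBlocks_mulVec]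
  simp only [mulVec_sub, sub_dotProduct, dotProduct_sub, hsymm] at hpos
  simp only [hs, dotProduct_neg] at hpos ⊢
  linarith

theorem stmt_12 (n m : ℕ)
    (Hxx : Matrix (Fin n) (Fin n) ℝ) (Hxu : Matrix (Fin n) (Fin m) ℝ)
    (Huu : Matrix (Fin m) (Fin m) ℝ)
    (hHxx : Hxxᵀ = Hxx) (hHuu : Huu.PosDef)
    (H : Matrix (Fin n ⊕ Fin m) (Fin n ⊕ Fin m) ℝ)
    (hH : H = Matrix.fromBlocks Hxx Hxu (Hxuᵀ) Huu)
    (x : Fin n → ℝ) :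
    ∀ u : Fin m → ℝ, u ≠ -(Huu⁻¹ * Hxuᵀ).mulVec x →
      (Sum.elim x (-(Huu⁻¹ * Hxuᵀ).mulVec x)) ⬝ᵥ
          H.mulVec (Sum.elim x (-(Huu⁻¹ * Hxuᵀ).mulVec x))
        < (Sum.elim x u) ⬝ᵥ H.mulVec (Sum.elim x u) := by
  intro u hu
  subst hH
  refine sumElim_dotProduct_fromBlocks_mulVec_lt Hxx Hxu hHuu x ?_ hu
  have hdet : IsUnit Huu.det := hHuu.det_pos.ne'.isUnit
  rw [mulVec_neg, mulVec_mulVec, mul_nonsing_inv_cancel_left _ _ hdet]
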